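/- For n ≥ 3 and any two non-scalar real n×n matrices A and B, there exist non-scalar matrices C₁, C₂, C₃ such that A commutes with C₁, C₁ commutes with C₂, C₂ commutes with C₃, and C₃ commutes with B; i.e., the diameter of the commuting graph of ℝ^{n×n} is at most 4. -/

import Mathlib

open Polynomial in
lemma aux_pow (p g : ℝ[X]) (hg : p ∣ g ^ 2 + 1) (i : ℕ) : ∃ g' : ℝ[X], p ^ i ∣ g' ^ 2 + 1 := by
  induction i with
  | zero => exact ⟨0, by simp⟩
  | succ i ih =>
    rcases Nat.eq_zero_or_pos i with rfl | hi
    · exact ⟨g, by simpa using hg⟩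
    obtain ⟨f, q, hq⟩ := ih
    refine ⟨f + C (1/2) * (f * (f ^ 2 + 1)), ?_⟩
    have h2 : (C (1/2 : ℝ)) * 2 = (1 : ℝ[X]) := by
      rw [← map_ofNat C 2, ← C_mul]; norm_num
    have e : (f + C (1/2) * (f * (f ^ 2 + 1))) ^ 2 + 1
        = (f ^ 2 + 1) ^ 2 * (1 + C (1/2) ^ 2 * f ^ 2) := by
      linear_combination (f ^ 2 * (f ^ 2 + 1)) * h2
    rw [e]
    apply Dvd.dvd.mul_right
    rw [hq, mul_pow, ← pow_mul]
    exact Dvd.dvd.mul_right (pow_dvd_pow _ (by omega)) _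

open Polynomial in
lemma aux_prime (p : ℝ[X]) (hp : Prime p) (hr : ∀ x : ℝ, p.eval x ≠ 0) :
    ∃ g : ℝ[X], p ∣ g ^ 2 + 1 := by
  have hirr := hp.irreducible
  have hdeg : 0 < (p.map (algebraMap ℝ ℂ)).degree := by
    rw [degree_map]; exact hirr.degree_pos
  obtain ⟨z, hz⟩ := Complex.exists_root hdeg
  have hz' : aeval z p = 0 := by
    rw [IsRoot, eval_map_algebraMap] at hz; exact hz
  have him : z.im ≠ 0 := by
    intro h
    apply hr z.re
    have : z = algebraMap ℝ ℂ z.re := by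
      apply Complex.ext <;> simp [h]
    rw [this, aeval_algebraMap_apply] at hz'
    simpa using hz'
  have hd := Polynomial.quadratic_dvd_of_aeval_eq_zero_im_ne_zero p hz' him
  have hnu : ¬ IsUnit (X ^ 2 - C (2 * z.re) * X + C (‖z‖ ^ 2) : ℝ[X]) := by
    intro hu
    have := natDegree_eq_zero_of_isUnit hu
    have h2 : (X ^ 2 - C (2 * z.re) * X + C (‖z‖ ^ 2) : ℝ[X]).natDegree = 2 := by compute_degree!
    omega
  have hd' := (hirr.dvd_iff.mp hd).resolve_left hnu
  refine ⟨C (z.im⁻¹) * (X - C z.re), hd'.dvd.trans ⟨C (z.im⁻¹ ^ 2), ?_⟩⟩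
  have hn : ‖z‖ ^ 2 = z.re ^ 2 + z.im ^ 2 := by
    rw [Complex.sq_norm, Complex.normSq_apply]; ring
  have h1 : (C z.im⁻¹ * C z.im : ℝ[X]) = 1 := by
    rw [← C_mul, inv_mul_cancel₀ him, C_1]
  rw [hn]
  simp only [C_add, C_mul, C_pow]
  have hc2 : (C 2 : ℝ[X]) = 2 := map_ofNat C 2
  rw [hc2]
  linear_combination (-(C z.im⁻¹ * C z.im) - 1) * h1

open Polynomial in
lemma aux_poly (m : ℝ[X]) : (∀ x : ℝ, m.eval x ≠ 0) → ∃ g : ℝ[X], m ∣ g ^ 2 + 1 := by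
  induction m using UniqueFactorizationMonoid.induction_on_coprime with
  | h0 => intro h; exact absurd (by simp) (h 0)
  | h1 hu => intro _; exact ⟨0, hu.dvd⟩
  | hpr i hp =>
    rename_i p
    intro h
    rcases Nat.eq_zero_or_pos i with rfl | hi
    · exact ⟨0, by simp⟩
    have : ∀ x : ℝ, p.eval x ≠ 0 := by
      intro x hx
      apply h x
      rw [eval_pow, hx, zero_pow (by omega)]
    obtain ⟨g, hg⟩ := aux_prime p hp this
    exact aux_pow p g hg i
  | hcp hc ha hb =>
    rename_i x y
    intro h
    obtain ⟨f, hf⟩ := ha (fun t ht => h t (by simp [ht]))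
    obtain ⟨g, hg⟩ := hb (fun t ht => h t (by simp [ht]))
    have hc' : IsCoprime x y := hc.isCoprime
    obtain ⟨u, v, huv⟩ := hc'
    refine ⟨f * (v * y) + g * (u * x), IsCoprime.mul_dvd ⟨u, v, huv⟩ ?_ ?_⟩
    · obtain ⟨q, hq⟩ := hf
      have : f * (v * y) + g * (u * x) = f + x * (u * (g - f)) := by
        linear_combination f * huv
      rw [this]
      exact ⟨q + 2 * f * (u * (g - f)) + x * (u * (g - f)) ^ 2, by linear_combination hq⟩
    · obtain ⟨q, hq⟩ := hg
      have : f * (v * y) + g * (u * x) = g + y * (v * (f - g)) := by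
        linear_combination g * huv
      rw [this]
      exact ⟨q + 2 * g * (v * (f - g)) + y * (v * (f - g)) ^ 2, by linear_combination hq⟩

open Matrix in
lemma aux_split {n : ℕ} (A : Matrix (Fin n) (Fin n) ℝ) :
    (∃ v w : Fin n → ℝ, v ≠ 0 ∧ w ≠ 0 ∧ A * vecMulVec v w = vecMulVec v w * A) ∨
    (∃ J : Matrix (Fin n) (Fin n) ℝ, J * J = -1 ∧ A * J = J * A) := by
  by_cases h : ∃ x : ℝ, A.charpoly.eval x = 0
  · left
    obtain ⟨x, hx⟩ := h
    rw [Matrix.eval_charpoly] at hx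
    obtain ⟨v, hv, hv'⟩ := Matrix.exists_mulVec_eq_zero_iff.mpr hx
    obtain ⟨w, hw, hw'⟩ := Matrix.exists_vecMul_eq_zero_iff.mpr hx
    refine ⟨v, w, hv, hw, ?_⟩
    rw [Matrix.sub_mulVec, sub_eq_zero] at hv'
    rw [Matrix.vecMul_sub, sub_eq_zero] at hw'
    rw [Matrix.mul_vecMulVec, Matrix.vecMulVec_mul, ← hv', ← hw']
    ext i j
    simp [vecMulVec_apply, Matrix.scalar_apply, mulVec_diagonal, vecMul_diagonal]
    ring
  · right
    push Not at h
    obtain ⟨g, q, hq⟩ := aux_poly _ h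
    refine ⟨Polynomial.aeval A g, ?_, ?_⟩
    · have := congrArg (Polynomial.aeval A) hq
      rw [map_mul, Matrix.aeval_self_charpoly, zero_mul, map_add, map_pow, map_one, pow_two] at this
      exact eq_neg_of_add_eq_zero_left this
    · simpa using congrArg (Polynomial.aeval A) (mul_comm Polynomial.X g)

lemma aux_J {n : ℕ} (hn : 3 ≤ n) {J : Matrix (Fin n) (Fin n) ℝ} (hJ : J * J = -1) :
    ¬ ∃ c : ℝ, J = c • (1 : Matrix (Fin n) (Fin n) ℝ) := by
  rintro ⟨c, rfl⟩
  have := congrFun (congrFun hJ ⟨0, by omega⟩) ⟨0, by omega⟩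
  simp at this
  nlinarith

open Matrix in
lemma aux_K {n : ℕ} (hn : 3 ≤ n) {J k : Matrix (Fin n) (Fin n) ℝ} (hJ : J * J = -1) {c : ℝ}
    (hk : k * k = c • 1) (hJk : J * k = - (k * J)) (hk0 : k ≠ 0) :
    ∃ X : Matrix (Fin n) (Fin n) ℝ, (¬ ∃ c : ℝ, X = c • (1 : Matrix (Fin n) (Fin n) ℝ)) ∧
      J * X = X * J ∧ k * X = X * k := by
  by_contra hcon
  push Not at hcon
  have hn0 : (n : ℝ) ≠ 0 := by positivity
  have hn3 : (3 : ℝ) ≤ n := by exact_mod_cast hn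
  have key : ∀ Z : Matrix (Fin n) (Fin n) ℝ, ∃ d : ℝ,
      c • (Z - J * Z * J) + k * (Z - J * Z * J) * k = d • 1 := by
    intro Z
    by_contra hd
    set Y := Z - J * Z * J with hY
    have hYJ : J * Y = Y * J := by
      have e1 : J * Y = J * Z - (J * J) * Z * J := by rw [hY]; noncomm_ring
      have e2 : Y * J = Z * J - J * Z * (J * J) := by rw [hY]; noncomm_ring
      rw [e1, e2, hJ]; noncomm_ring
    refine hcon _ (not_exists.mp hd) ?_ ?_
    · have e : J * (k * Y * k) = (k * Y * k) * J := by
        calc J * (k * Y * k) = (J * k) * Y * k := by noncomm_ring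
          _ = - (k * (J * Y) * k) := by rw [hJk]; noncomm_ring
          _ = - (k * Y * (J * k)) := by rw [hYJ]; noncomm_ring
          _ = _ := by rw [hJk]; noncomm_ring
      rw [mul_add, add_mul, e, mul_smul_comm, smul_mul_assoc, hYJ]
    · have e1 : k * (k * Y * k) = c • (Y * k) := by
        calc _ = (k * k) * (Y * k) := by noncomm_ring
          _ = _ := by rw [hk]; simp
      have e2 : (k * Y * k) * k = c • (k * Y) := by
        calc _ = (k * Y) * (k * k) := by noncomm_ring
          _ = _ := by rw [hk]; simp
      rw [mul_add, add_mul, e1, e2, mul_smul_comm, smul_mul_assoc, add_comm]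
  have trJ : ∀ Z : Matrix (Fin n) (Fin n) ℝ, (J * Z * J).trace = - Z.trace := by
    intro Z
    rw [Matrix.trace_mul_comm, ← mul_assoc, hJ]; simp
  have trk : ∀ Z : Matrix (Fin n) (Fin n) ℝ, (k * Z * k).trace = c * Z.trace := by
    intro Z
    rw [Matrix.trace_mul_comm, ← mul_assoc, hk]; simp
  have key2 : ∀ Z : Matrix (Fin n) (Fin n) ℝ,
      c • (Z - J * Z * J) + k * (Z - J * Z * J) * k = (4 * c * Z.trace / n) • 1 := by
    intro Z
    obtain ⟨d, hd⟩ := key Z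
    have ht := congrArg Matrix.trace hd
    rw [Matrix.trace_add, trk, Matrix.trace_smul, Matrix.trace_sub, trJ, Matrix.trace_smul,
      Matrix.trace_one, Fintype.card_fin] at ht
    simp only [smul_eq_mul] at ht
    rw [hd]
    congr 1
    field_simp
    linarith
  have ent : ∀ (a b : Matrix (Fin n) (Fin n) ℝ) (i j p q : Fin n),
      (a * Matrix.single i j (1 : ℝ) * b) p q = a p i * b j q := by
    intro a b i j p q
    rw [Matrix.mul_assoc, Matrix.mul_apply, Finset.sum_eq_single i]
    · simp
    · intro x _ hx
      rw [Matrix.single_mul_apply_of_ne _ _ _ _ _ hx, mul_zero]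
    · simp
  by_cases hc : c = 0
  · subst hc
    have e : ∀ Z : Matrix (Fin n) (Fin n) ℝ, k * Z * (k * J) = (k * J) * Z * k := by
      intro Z
      have h0 := key2 Z
      simp only [zero_smul, zero_add, mul_zero, zero_mul, zero_div] at h0
      have h1 : k * Z * k = k * J * Z * (J * k) := by
        rw [← sub_eq_zero, ← h0]; noncomm_ring
      calc k * Z * (k * J) = (k * Z * k) * J := by noncomm_ring
        _ = k * J * Z * (J * k) * J := by rw [h1]
        _ = -(k * J * Z * k * (J * J)) := by rw [hJk]; noncomm_ring
        _ = _ := by rw [hJ]; noncomm_ring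
    obtain ⟨a, i, hai⟩ : ∃ a i, k a i ≠ 0 := by
      by_contra! h
      exact hk0 (by ext a i; simpa using h a i)
    have hmu : k * J = ((k * J) a i / k a i) • k := by
      ext j b
      have := congrFun (congrFun (e (Matrix.single i j 1)) a) b
      rw [ent, ent] at this
      rw [Matrix.smul_apply, smul_eq_mul]
      field_simp
      linarith
    set μ := (k * J) a i / k a i
    have h2 : k * J * J = (μ * μ) • k := by
      conv_lhs => rw [hmu]
      rw [smul_mul_assoc, hmu, smul_smul]
    rw [mul_assoc, hJ] at h2
    have h3 := congrFun (congrFun h2 a) i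
    simp at h3
    have : (μ * μ + 1) * k a i = 0 := by linarith
    rcases mul_eq_zero.mp this with h | h
    · nlinarith
    · exact hai h
  · have t1 : J.trace = 0 := by
      have h1 := trk J
      have h2 : k * J * k = - (c • J) := by
        rw [mul_assoc, hJk]
        calc k * -(k * J) = -((k * k) * J) := by noncomm_ring
          _ = _ := by rw [hk]; simp
      rw [h2, Matrix.trace_neg, Matrix.trace_smul, smul_eq_mul] at h1
      have : c * J.trace = 0 := by linarith
      exact (mul_eq_zero.mp this).resolve_left hc
    have t2 : k.trace = 0 := by
      have h1 := trJ k
      have h2 : J * k * J = k := by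
        rw [hJk]
        calc -(k * J) * J = -(k * (J * J)) := by noncomm_ring
          _ = _ := by rw [hJ]; simp
      rw [h2] at h1; linarith
    have t3 : (k * J).trace = 0 := by
      have h := congrArg Matrix.trace hJk
      rw [Matrix.trace_neg, Matrix.trace_mul_comm] at h
      linarith
    have E : ∀ i j : Fin n, c * 1 - c * (J i i * J j j) + k i i * k j j
        - (k * J) i i * (J * k) j j = (4 * c / n) * (if i = j then 1 else 0) := by
      intro i j
      have h := congrFun (congrFun (key2 (Matrix.single i j 1)) i) j
      have h1 : k * (Matrix.single i j 1 - J * Matrix.single i j 1 * J) * k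
        = k * Matrix.single i j 1 * k - (k * J) * Matrix.single i j 1 * (J * k) := by
        noncomm_ring
      rw [h1, Matrix.add_apply, Matrix.smul_apply, Matrix.sub_apply, Matrix.sub_apply,
        ent, ent, ent, Matrix.smul_apply] at h
      by_cases hij : i = j
      · subst hij
        simp at h ⊢
        linarith
      · simp [hij] at h ⊢
        linarith
    have S : ∑ i : Fin n, ∑ j : Fin n, (c * 1 - c * (J i i * J j j) + k i i * k j j
        - (k * J) i i * (J * k) j j) = ∑ i : Fin n, ∑ j : Fin n,
          (4 * c / n) * (if i = j then (1 : ℝ) else 0) :=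
      Finset.sum_congr rfl fun i _ => Finset.sum_congr rfl fun j _ => E i j
    have f : ∀ a b : Matrix (Fin n) (Fin n) ℝ,
        ∑ i : Fin n, ∑ j : Fin n, a i i * b j j = a.trace * b.trace := by
      intro a b
      rw [Matrix.trace, Matrix.trace, Finset.sum_mul_sum]; rfl
    simp only [Finset.sum_add_distrib, Finset.sum_sub_distrib, ← Finset.mul_sum] at S
    simp only [Finset.mul_sum] at S
    simp only [← Finset.mul_sum (a := c)] at S
    simp only [f, t1, t2, t3] at S
    simp at S
    field_simp at S
    nlinarith

lemma aux_JJ {n : ℕ} (hn : 3 ≤ n) {J L : Matrix (Fin n) (Fin n) ℝ} (hJ : J * J = -1)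
    (hL : L * L = -1) :
    ∃ X : Matrix (Fin n) (Fin n) ℝ, (¬ ∃ c : ℝ, X = c • (1 : Matrix (Fin n) (Fin n) ℝ)) ∧
      J * X = X * J ∧ L * X = X * L := by
  by_cases h : ∃ c : ℝ, J * L + L * J = c • (1 : Matrix (Fin n) (Fin n) ℝ)
  · obtain ⟨s, hs⟩ := h
    have hLJ : L * J = s • 1 - J * L := by rw [← hs]; abel
    set k := (2 : ℝ) • L + s • J with hkdef
    have hLk : L = (1 / 2 : ℝ) • (k - s • J) := by
      rw [hkdef, add_sub_cancel_right, smul_smul]; norm_num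
    by_cases hk0 : k = 0
    · refine ⟨J, aux_J hn hJ, rfl, ?_⟩
      rw [hLk, hk0]; simp
    have h1 : J * k = -(k * J) := by
      rw [hkdef, mul_add, add_mul, mul_smul_comm, mul_smul_comm, smul_mul_assoc, smul_mul_assoc,
        hJ, hLJ]
      module
    have h2 : k * k = (s ^ 2 - 4) • (1 : Matrix (Fin n) (Fin n) ℝ) := by
      rw [hkdef]
      simp only [mul_add, add_mul, mul_smul_comm, smul_mul_assoc, hJ, hL, hLJ]
      module
    obtain ⟨X, hX, hX1, hX2⟩ := aux_K hn hJ h2 h1 hk0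
    refine ⟨X, hX, hX1, ?_⟩
    rw [hLk, smul_mul_assoc, mul_smul_comm, sub_mul, mul_sub, smul_mul_assoc, mul_smul_comm,
      hX1, hX2]
  · refine ⟨_, h, ?_, ?_⟩
    · calc J * (J * L + L * J) = (J * J) * L + J * L * J := by noncomm_ring
        _ = L * (J * J) + J * L * J := by rw [hJ]; noncomm_ring
        _ = _ := by noncomm_ring
    · calc L * (J * L + L * J) = (L * L) * J + L * J * L := by noncomm_ring
        _ = J * (L * L) + L * J * L := by rw [hL]; noncomm_ring
        _ = _ := by noncomm_ring

open Matrix in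
lemma aux_orth {n : ℕ} (hn : 3 ≤ n) (a b : Fin n → ℝ) :
    ∃ p : Fin n → ℝ, p ≠ 0 ∧ a ⬝ᵥ p = 0 ∧ b ⬝ᵥ p = 0 := by
  let M : Matrix (Fin 2) (Fin n) ℝ := Matrix.of ![a, b]
  have : ∃ p, p ≠ 0 ∧ M *ᵥ p = 0 := by
    have hlt : Module.finrank ℝ (Fin 2 → ℝ) < Module.finrank ℝ (Fin n → ℝ) := by simp; omega
    have hb := LinearMap.ker_ne_bot_of_finrank_lt (f := M.mulVecLin) hlt
    obtain ⟨p, hp, hp0⟩ := Submodule.exists_mem_ne_zero_of_ne_bot hb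
    exact ⟨p, hp0, by simpa using hp⟩
  obtain ⟨p, hp, h⟩ := this
  exact ⟨p, hp, congrFun h 0, congrFun h 1⟩

open Matrix in
lemma aux_nonscalar {n : ℕ} {X : Matrix (Fin n) (Fin n) ℝ} {v : Fin n → ℝ} (hv : v ≠ 0)
    (hX : X ≠ 0) (h : X *ᵥ v = 0) : ¬ ∃ c : ℝ, X = c • (1 : Matrix (Fin n) (Fin n) ℝ) := by
  rintro ⟨c, rfl⟩
  rw [smul_mulVec, one_mulVec] at h
  rcases smul_eq_zero.mp h with h | h
  · exact hX (by simp [h])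
  · exact hv h

open Matrix in
lemma aux_vne {n : ℕ} {v w : Fin n → ℝ} (hv : v ≠ 0) (hw : w ≠ 0) : vecMulVec v w ≠ 0 := by
  obtain ⟨i, hi⟩ := Function.ne_iff.mp hv
  obtain ⟨j, hj⟩ := Function.ne_iff.mp hw
  intro h
  have := congrFun (congrFun h i) j
  simp [vecMulVec_apply] at this
  tauto

open Matrix in
lemma aux_rank_one_nonscalar {n : ℕ} (hn : 3 ≤ n) {v w : Fin n → ℝ} (hv : v ≠ 0) (hw : w ≠ 0) :
    ¬ ∃ c : ℝ, vecMulVec v w = c • (1 : Matrix (Fin n) (Fin n) ℝ) := by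
  obtain ⟨p, hp, h, -⟩ := aux_orth hn w w
  refine aux_nonscalar hp (aux_vne hv hw) ?_
  rw [vecMulVec_mulVec, h]; simp

open Matrix in
lemma aux_RR {n : ℕ} (hn : 3 ≤ n) (v w x y : Fin n → ℝ) (hv : v ≠ 0) :
    ∃ X : Matrix (Fin n) (Fin n) ℝ, (¬ ∃ c : ℝ, X = c • (1 : Matrix (Fin n) (Fin n) ℝ)) ∧
      vecMulVec v w * X = X * vecMulVec v w ∧ vecMulVec x y * X = X * vecMulVec x y := by
  obtain ⟨p, hp, hp1, hp2⟩ := aux_orth hn w y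
  obtain ⟨q, hq, hq1, hq2⟩ := aux_orth hn v x
  refine ⟨vecMulVec p q, aux_rank_one_nonscalar hn hp hq, ?_, ?_⟩
  · rw [vecMulVec_mul_vecMulVec, vecMulVec_mul_vecMulVec, hp1, dotProduct_comm q v, hq1]; simp
  · rw [vecMulVec_mul_vecMulVec, vecMulVec_mul_vecMulVec, hp2, dotProduct_comm q x, hq2]; simp

open Matrix in
lemma aux_RJ {n : ℕ} (hn : 3 ≤ n) (v w : Fin n → ℝ) (hv : v ≠ 0)
    {J : Matrix (Fin n) (Fin n) ℝ} (hJ : J * J = -1) :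
    ∃ X : Matrix (Fin n) (Fin n) ℝ, (¬ ∃ c : ℝ, X = c • (1 : Matrix (Fin n) (Fin n) ℝ)) ∧
      vecMulVec v w * X = X * vecMulVec v w ∧ J * X = X * J := by
  obtain ⟨p, hp, hp1, hp2⟩ := aux_orth hn w (w ᵥ* J)
  obtain ⟨q, hq, hq1, hq2⟩ := aux_orth hn v (J *ᵥ v)
  set X := vecMulVec p q - J * vecMulVec p q * J with hX
  have hXv : X *ᵥ v = 0 := by
    rw [hX, sub_mulVec, vecMulVec_mulVec, dotProduct_comm q v, hq1, ← mulVec_mulVec,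
      ← mulVec_mulVec, vecMulVec_mulVec, dotProduct_comm q, hq2]
    simp
  have hwX : w ᵥ* X = 0 := by
    rw [hX, vecMul_sub, ← vecMul_vecMul, ← vecMul_vecMul, vecMul_vecMulVec, vecMul_vecMulVec,
      hp1, hp2]
    simp
  have hX0 : X ≠ 0 := by
    intro h0
    obtain ⟨j, hj⟩ := Function.ne_iff.mp hq
    simp only [Pi.zero_apply] at hj
    have h1 : J * vecMulVec p q = - (vecMulVec p q * J) := by
      rw [hX, sub_eq_zero] at h0
      conv_rhs => rw [h0, mul_assoc, hJ]
      simp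
    rw [mul_vecMulVec, vecMulVec_mul] at h1
    have h2 : J *ᵥ p = (-((q ᵥ* J) j) / q j) • p := by
      ext i
      have := congrFun (congrFun h1 i) j
      simp only [vecMulVec_apply, Matrix.neg_apply] at this
      rw [Pi.smul_apply, smul_eq_mul]
      field_simp
      linarith
    set t := -((q ᵥ* J) j) / q j
    have h3 : J *ᵥ (J *ᵥ p) = (t * t) • p := by
      rw [h2, mulVec_smul, h2, smul_smul]
    rw [mulVec_mulVec, hJ, neg_mulVec, one_mulVec] at h3
    obtain ⟨i, hi⟩ := Function.ne_iff.mp hp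
    have h4 := congrFun h3 i
    simp at h4 hi
    have : (t * t + 1) * p i = 0 := by linarith
    rcases mul_eq_zero.mp this with h | h
    · nlinarith
    · exact hi h
  refine ⟨X, aux_nonscalar hv hX0 hXv, ?_, ?_⟩
  · rw [vecMulVec_mul, mul_vecMulVec, hXv, hwX]; simp
  · have e1 : J * X = J * vecMulVec p q - (J * J) * vecMulVec p q * J := by rw [hX]; noncomm_ring
    have e2 : X * J = vecMulVec p q * J - J * vecMulVec p q * (J * J) := by rw [hX]; noncomm_ring
    rw [e1, e2, hJ]; noncomm_ring



theorem stmt7 (n : ℕ) (hn : 3 ≤ n) (A B : Matrix (Fin n) (Fin n) ℝ)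
    (hA : ¬ ∃ c : ℝ, A = c • (1 : Matrix (Fin n) (Fin n) ℝ))
    (hB : ¬ ∃ c : ℝ, B = c • (1 : Matrix (Fin n) (Fin n) ℝ)) :
    ∃ C₁ C₂ C₃ : Matrix (Fin n) (Fin n) ℝ,
      (¬ ∃ c : ℝ, C₁ = c • (1 : Matrix (Fin n) (Fin n) ℝ)) ∧
      (¬ ∃ c : ℝ, C₂ = c • (1 : Matrix (Fin n) (Fin n) ℝ)) ∧
      (¬ ∃ c : ℝ, C₃ = c • (1 : Matrix (Fin n) (Fin n) ℝ)) ∧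
      A * C₁ = C₁ * A ∧ C₁ * C₂ = C₂ * C₁ ∧
      C₂ * C₃ = C₃ * C₂ ∧ C₃ * B = B * C₃ := by
  rcases aux_split A with ⟨v, w, hv, hw, hA1⟩ | ⟨J, hJ, hA1⟩ <;>
  rcases aux_split B with ⟨x, y, hx, hy, hB1⟩ | ⟨L, hL, hB1⟩
  · obtain ⟨X, hX, h1, h2⟩ := aux_RR hn v w x y hv
    exact ⟨_, X, _, aux_rank_one_nonscalar hn hv hw, hX, aux_rank_one_nonscalar hn hx hy,
      hA1, h1, h2.symm, hB1.symm⟩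
  · obtain ⟨X, hX, h1, h2⟩ := aux_RJ hn v w hv hL
    exact ⟨_, X, _, aux_rank_one_nonscalar hn hv hw, hX, aux_J hn hL, hA1, h1, h2.symm, hB1.symm⟩
  · obtain ⟨X, hX, h1, h2⟩ := aux_RJ hn x y hx hJ
    exact ⟨_, X, _, aux_J hn hJ, hX, aux_rank_one_nonscalar hn hx hy, hA1, h2, h1.symm, hB1.symm⟩
  · obtain ⟨X, hX, h1, h2⟩ := aux_JJ hn hJ hL
    exact ⟨_, X, _, aux_J hn hJ, hX, aux_J hn hL, hA1, h1, h2.symm, hB1.symm⟩
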